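/- There exists a universal constant c > 0 such that for every integer d ≥ 1 and every real λ with 10 ≤ λ ≤ d/10, Bernoulli bond percolation with parameter λ/d on the oriented hypercube Q⃗_d satisfies P_{λ/d}((0,…,0) → (1,…,1)) ≥ 1 − 2·exp(−c·λ). -/

import Mathlib

open MeasureTheory ProbabilityTheory

noncomputable section

/-- The directed edges of the oriented hypercube `Q⃗_d`: ordered pairs `(x, y)` of vertices
of `{0,1}^d` such that `y` is obtained from `x` by flipping a single coordinate from
`false` to `true`. -/
def HCEdge (d : ℕ) : Type :=
  {e : (Fin d → Bool) × (Fin d → Bool) //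
    ∃ i : Fin d, e.1 i = false ∧ e.2 = Function.update e.1 i true}


instance (d : ℕ) : Fintype (HCEdge d) := by
  unfold HCEdge; infer_instance

instance (d : ℕ) : DecidableEq (HCEdge d) := by
  unfold HCEdge; infer_instance

/-- The Bernoulli measure on `Bool` giving mass `p` to `true` and `1 − p` to `false`. -/
def bernoulliBool (p : ℝ) : Measure Bool :=
  ENNReal.ofReal p • Measure.dirac true + ENNReal.ofReal (1 - p) • Measure.dirac false

/-- Bernoulli bond percolation on the oriented hypercube `Q⃗_d` with parameter `p`:
each directed edge is open (`true`) independently with probability `p`. -/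
def percMeasure (d : ℕ) (p : ℝ) : Measure (HCEdge d → Bool) :=
  Measure.pi fun _ => bernoulliBool p

/-- The event `x → y`: there is a directed path from `x` to `y` all of whose edges are
open in the configuration `cfg`. -/
def percReach {d : ℕ} (cfg : HCEdge d → Bool) (x y : Fin d → Bool) : Prop :=
  Relation.ReflTransGen
    (fun a b => ∃ e : HCEdge d, cfg e = true ∧ e.1.1 = a ∧ e.1.2 = b) x y

section Auxiliary

open Finset
open scoped Nat

theorem factorial_le_two_mul_half_pow (n : ℕ) : (n ! : ℝ) ≤ 2 * ((n : ℝ) / 2) ^ n := by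
  induction n with
  | zero => simp
  | succ n ih =>
    rcases Nat.eq_zero_or_pos n with rfl | hn
    · norm_num
    have hn' : (0 : ℝ) < n := by exact_mod_cast hn
    have hb : (2 : ℝ) ≤ (1 + 1 / (n : ℝ)) ^ n := by
      have h := one_add_mul_le_pow (a := 1 / (n : ℝ))
        (by have : (0 : ℝ) ≤ 1 / (n : ℝ) := by positivity
            linarith) n
      have h2 : (n : ℝ) * (1 / (n : ℝ)) = 1 := by field_simp
      linarith
    calc (((n + 1)! : ℕ) : ℝ) = ((n : ℝ) + 1) * n ! := by
          rw [Nat.factorial_succ]; push_cast; ring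
      _ ≤ ((n : ℝ) + 1) * (2 * ((n : ℝ) / 2) ^ n) := by gcongr
      _ ≤ ((n : ℝ) + 1) * ((1 + 1 / (n : ℝ)) ^ n * ((n : ℝ) / 2) ^ n) := by gcongr
      _ = ((n : ℝ) + 1) * (((n : ℝ) + 1) / 2) ^ n := by
          rw [← mul_pow]; congr 2; field_simp
      _ = 2 * ((((n + 1 : ℕ) : ℝ)) / 2) ^ (n + 1) := by
          rw [pow_succ]; push_cast; ring

theorem sum_factorial_mul_pow_le {θ : ℝ} (hθ : 0 ≤ θ) (n : ℕ) :
    ∑ t ∈ range (n + 1), (t ! : ℝ) * θ ^ t ≤ 8 + 3 * ((n ! : ℝ) * θ ^ n) := by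
  induction n with
  | zero => norm_num
  | succ n ih =>
    have hrec : ((n + 1)! : ℝ) * θ ^ (n + 1) = ((n : ℝ) + 1) * θ * ((n ! : ℝ) * θ ^ n) := by
      rw [Nat.factorial_succ]; push_cast; ring
    have hx : 0 ≤ (n ! : ℝ) * θ ^ n := by positivity
    by_cases hsmall : ((n : ℝ) + 1) * θ ≤ 3 / 2
    · have h1 : ∑ t ∈ range (n + 1 + 1), (t ! : ℝ) * θ ^ t
          ≤ ∑ t ∈ range (n + 1 + 1), 2 * (3 / 4 : ℝ) ^ t := by
        refine sum_le_sum fun t ht => ?_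
        have ht' : (t : ℝ) ≤ n + 1 := by exact_mod_cast Nat.lt_succ_iff.mp (mem_range.mp ht)
        calc (t ! : ℝ) * θ ^ t ≤ 2 * ((t : ℝ) / 2) ^ t * θ ^ t := by
              gcongr; exact factorial_le_two_mul_half_pow t
          _ = 2 * ((t : ℝ) * θ / 2) ^ t := by rw [mul_assoc, ← mul_pow]; ring_nf
          _ ≤ 2 * (3 / 4 : ℝ) ^ t := by
              have : (t : ℝ) * θ / 2 ≤ 3 / 4 := by nlinarith
              gcongr
      have h2 : ∑ t ∈ range (n + 1 + 1), 2 * (3 / 4 : ℝ) ^ t ≤ 8 := by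
        have h := geom_sum_eq (by norm_num : (3 / 4 : ℝ) ≠ 1) (n + 1 + 1)
        have : (0 : ℝ) < (3 / 4) ^ (n + 1 + 1) := by positivity
        rw [← mul_sum, h, mul_div_assoc', div_le_iff_of_neg (by norm_num)]
        linarith
      have h3 : 0 ≤ 3 * (((n + 1)! : ℝ) * θ ^ (n + 1)) := by positivity
      linarith
    · rw [sum_range_succ, hrec]
      push Not at hsmall
      nlinarith

theorem sum_factorial_mul_geom_le {p ρ : ℝ} (hp : 0 ≤ p) (hρ : 0 < ρ) (n : ℕ) :
    ∑ t ∈ range (n + 1), (t ! : ℝ) * p ^ t * ρ ^ (n - t) ≤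
      8 * ρ ^ n + 3 * ((n ! : ℝ) * p ^ n) := by
  have h := mul_le_mul_of_nonneg_right
    (sum_factorial_mul_pow_le (θ := p / ρ) (by positivity) n) (pow_nonneg hρ.le n)
  rw [sum_mul] at h
  calc _ = ∑ t ∈ range (n + 1), (t ! : ℝ) * (p / ρ) ^ t * ρ ^ n := by
        refine sum_congr rfl fun t ht => ?_
        have ht' : t ≤ n := Nat.lt_succ_iff.mp (mem_range.mp ht)
        rw [← Nat.sub_add_cancel ht', pow_add, Nat.add_sub_cancel, div_pow]
        field_simp
    _ ≤ _ := h
    _ = _ := by rw [div_pow]; field_simp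

theorem factorial_mul_factorial_le_factorial_pred (i j : ℕ) :
    (i + 1)! * (j + 1)! ≤ (i + j + 1)! := by
  induction j with
  | zero => simp
  | succ j ih =>
    calc (i + 1)! * (j + 1 + 1)! = (j + 2) * ((i + 1)! * (j + 1)!) := by
          rw [Nat.factorial_succ (j + 1)]; ring
      _ ≤ (i + j + 2) * (i + j + 1)! := by gcongr; omega
      _ = (i + (j + 1) + 1)! := by
          rw [show i + (j + 1) + 1 = (i + j + 1) + 1 by ring, Nat.factorial_succ (i + j + 1)]

theorem sum_factorial_mul_factorial_le (n : ℕ) :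
    ∑ t ∈ range (n + 1), t ! * (n - t)! ≤ 3 * n ! := by
  rcases n with _ | n
  · simp
  rw [sum_range_succ, sum_range_succ']
  have h : ∑ k ∈ range n, (k + 1)! * (n + 1 - (k + 1))! ≤ ∑ k ∈ range n, n ! := by
    refine sum_le_sum fun k hk => ?_
    have hk' := mem_range.mp hk
    obtain ⟨j, rfl⟩ : ∃ j, n = k + j + 1 := ⟨n - k - 1, by omega⟩
    rw [show k + j + 1 + 1 - (k + 1) = j + 1 by omega]
    exact factorial_mul_factorial_le_factorial_pred k j
  rw [sum_const, card_range, smul_eq_mul] at h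
  have : (n + 1)! = n * n ! + n ! := by rw [Nat.factorial_succ]; ring
  simp only [Nat.factorial_zero, Nat.sub_self, Nat.sub_zero, one_mul, mul_one]
  omega

/-- The solution of the renewal equation `v n = a n + ∑ t < n, a t * v (n - 1 - t)` with
`a n = n! p ^ n`. -/
def renewalSeq (p : ℝ) (n : ℕ) : ℝ :=
  (n ! : ℝ) * p ^ n + ∑ t : Fin n, ((t : ℕ)! : ℝ) * p ^ (t : ℕ) * renewalSeq p (n - 1 - t)
termination_by n
decreasing_by have := t.2; omega

theorem renewalSeq_eq (p : ℝ) (n : ℕ) : renewalSeq p n = (n ! : ℝ) * p ^ n +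
    ∑ t ∈ range n, (t ! : ℝ) * p ^ t * renewalSeq p (n - 1 - t) := by
  rw [renewalSeq, Fin.sum_univ_eq_sum_range
    (fun t => (t ! : ℝ) * p ^ t * renewalSeq p (n - 1 - t))]

theorem factorial_mul_pow_le_pow {p K : ℝ} (hp : 0 ≤ p) {t : ℕ} (h : p * t ≤ K) :
    (t ! : ℝ) * p ^ t ≤ K ^ t := by
  have h1 : (t ! : ℝ) ≤ (t : ℝ) ^ t := by exact_mod_cast Nat.factorial_le_pow t
  calc (t ! : ℝ) * p ^ t ≤ (t : ℝ) ^ t * p ^ t := by gcongr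
    _ = (p * t) ^ t := by rw [mul_comm, mul_pow]
    _ ≤ K ^ t := by gcongr

theorem pow_add_sum_pow_mul_succ_pow (K : ℝ) (n : ℕ) :
    K ^ n + ∑ t ∈ range n, K ^ t * (K + 1) ^ (n - 1 - t) = (K + 1) ^ n := by
  have h := (Commute.all K (K + 1)).geom_sum₂_mul n
  linarith

theorem renewalSeq_le_pow {p K : ℝ} (hp : 0 ≤ p) (hK : 0 ≤ K) (n : ℕ) (h : p * n ≤ K) :
    renewalSeq p n ≤ (K + 1) ^ n := by
  induction n using Nat.strong_induction_on with
  | _ n ih =>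
    have hmono : ∀ m ≤ n, p * m ≤ K := fun m hm =>
      (mul_le_mul_of_nonneg_left (by exact_mod_cast hm) hp).trans h
    rw [renewalSeq_eq, ← pow_add_sum_pow_mul_succ_pow]
    refine add_le_add (factorial_mul_pow_le_pow hp h) (sum_le_sum fun t ht => ?_)
    have ht' := mem_range.mp ht
    have h1 := factorial_mul_pow_le_pow hp (hmono t ht'.le)
    have h2 := ih (n - 1 - t) (by omega) (hmono _ (by omega))
    calc _ ≤ (t ! : ℝ) * p ^ t * (K + 1) ^ (n - 1 - t) := by gcongr
      _ ≤ _ := by gcongr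

theorem sum_factorial_mul_le_of_le {p ρ C : ℝ} (hp : 0 ≤ p) (hρ : 0 < ρ) (hC : 0 ≤ C)
    {v : ℕ → ℝ} (n : ℕ) (hv : ∀ m ≤ n, v m ≤ ρ ^ m + C * ((m ! : ℝ) * p ^ m)) :
    ∑ t ∈ range (n + 1), (t ! : ℝ) * p ^ t * v (n - t) ≤
      8 * ρ ^ n + (3 + 3 * C) * ((n ! : ℝ) * p ^ n) := by
  have h2 : ∑ t ∈ range (n + 1), (t ! : ℝ) * ((n - t)! : ℝ) ≤ 3 * n ! := by
    exact_mod_cast sum_factorial_mul_factorial_le n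
  calc _ ≤ ∑ t ∈ range (n + 1), ((t ! : ℝ) * p ^ t * ρ ^ (n - t) +
          C * p ^ n * ((t ! : ℝ) * ((n - t)! : ℝ))) := by
        refine sum_le_sum fun t ht => ?_
        have ht' : t ≤ n := Nat.lt_succ_iff.mp (mem_range.mp ht)
        have hpn : p ^ n = p ^ t * p ^ (n - t) := by rw [← pow_add]; congr 1; omega
        calc _ ≤ (t ! : ℝ) * p ^ t *
              (ρ ^ (n - t) + C * (((n - t)! : ℝ) * p ^ (n - t))) := by
              gcongr; exact hv _ (Nat.sub_le _ _)
          _ = _ := by rw [hpn]; ring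
    _ = ∑ t ∈ range (n + 1), (t ! : ℝ) * p ^ t * ρ ^ (n - t) +
          C * p ^ n * ∑ t ∈ range (n + 1), (t ! : ℝ) * ((n - t)! : ℝ) := by
        rw [sum_add_distrib, mul_sum]
    _ ≤ (8 * ρ ^ n + 3 * ((n ! : ℝ) * p ^ n)) + C * p ^ n * (3 * n !) := by
        gcongr
        exact sum_factorial_mul_geom_le hp hρ n
    _ = _ := by ring

theorem renewalSeq_le {p : ℝ} (hp : 0 ≤ p) (n : ℕ) :
    renewalSeq p n ≤ 8 ^ n + 3 * ((n ! : ℝ) * p ^ n) := by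
  induction n using Nat.strong_induction_on with
  | _ n ih =>
    by_cases hn : p * n ≤ 7
    · have h := renewalSeq_le_pow hp (by norm_num) n hn
      have : 0 ≤ 3 * ((n ! : ℝ) * p ^ n) := by positivity
      norm_num at h
      linarith
    · rcases n with _ | n
      · norm_num at hn
      push Not at hn
      push_cast at hn
      have h := sum_factorial_mul_le_of_le (v := renewalSeq p) hp (by norm_num : (0 : ℝ) < 8)
        (by norm_num : (0 : ℝ) ≤ 3) n (fun m hm => ih m (by omega))
      rw [renewalSeq_eq]
      have hrec : ((n + 1)! : ℝ) * p ^ (n + 1) = p * ((n : ℝ) + 1) * ((n ! : ℝ) * p ^ n) := by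
        rw [Nat.factorial_succ]; push_cast; ring
      have hx : 0 ≤ (n ! : ℝ) * p ^ n := by positivity
      simp only [Nat.add_sub_cancel]
      have h8 : (8 : ℝ) ^ (n + 1) = 8 * 8 ^ n := by ring
      rw [hrec, h8]
      nlinarith

theorem sum_factorial_mul_renewalSeq_le {p : ℝ} (hp : 0 ≤ p) (n : ℕ) :
    ∑ t ∈ range (n + 1), (t ! : ℝ) * p ^ t * renewalSeq p (n - t) ≤
      8 ^ (n + 1) + 12 * ((n ! : ℝ) * p ^ n) := by
  have h := sum_factorial_mul_le_of_le (v := renewalSeq p) hp (by norm_num : (0 : ℝ) < 8)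
    (by norm_num : (0 : ℝ) ≤ 3) n (fun m _ => renewalSeq_le hp m)
  have h8 : (8 : ℝ) ^ (n + 1) = 8 * 8 ^ n := by ring
  linarith

theorem div_three_pow_le_factorial (n : ℕ) : ((n : ℝ) / 3) ^ n ≤ n ! := by
  have h := Real.pow_div_factorial_le_exp (n : ℝ) (by positivity) n
  have he : Real.exp n ≤ 3 ^ n := by
    rw [← Real.exp_one_pow]
    have := Real.exp_one_lt_d9
    gcongr
    linarith
  have hf : (0 : ℝ) < n ! := by positivity
  rw [div_pow, div_le_iff₀ (by positivity)]
  rw [div_le_iff₀ hf] at h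
  nlinarith

theorem sum_factorial_mul_renewalSeq_le_div {d : ℕ} {lam : ℝ} (hd : 4 ≤ d)
    (hlam : 72 ≤ lam) :
    ∑ t ∈ range d, (t ! : ℝ) * (lam / d) ^ t * renewalSeq (lam / d) (d - 1 - t) ≤
      13 / lam * ((d ! : ℝ) * (lam / d) ^ d) := by
  obtain ⟨n, rfl⟩ : ∃ n, d = n + 1 := ⟨d - 1, by omega⟩
  set p : ℝ := lam / ((n + 1 : ℕ) : ℝ) with hp
  have hd0 : (0 : ℝ) < ((n + 1 : ℕ) : ℝ) := by positivity
  have hl0 : 0 < lam := by linarith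
  have hpd : p * ((n : ℝ) + 1) = lam := by rw [hp]; push_cast; field_simp
  have h := sum_factorial_mul_renewalSeq_le (p := p) (by positivity) n
  have hrec : ((n + 1)! : ℝ) * p ^ (n + 1) = lam * ((n ! : ℝ) * p ^ n) := by
    rw [Nat.factorial_succ, ← hpd]; push_cast; ring
  have hlow : (lam / 3) ^ (n + 1) ≤ ((n + 1)! : ℝ) * p ^ (n + 1) := by
    calc (lam / 3) ^ (n + 1) = (((n + 1 : ℕ) : ℝ) / 3) ^ (n + 1) * p ^ (n + 1) := by
          rw [← mul_pow]; congr 1; rw [hp]; field_simp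
      _ ≤ _ := by gcongr; exact div_three_pow_le_factorial _
  have h8 : (8 : ℝ) ^ (n + 1) ≤ (n ! : ℝ) * p ^ n := by
    have h1 : lam * (8 : ℝ) ^ (n + 1) ≤ (lam / 3) ^ (n + 1) := by
      calc lam * (8 : ℝ) ^ (n + 1) = lam / 3 * (24 * 8 ^ n) := by ring
        _ ≤ lam / 3 * (3 ^ n * 8 ^ n) := by
            gcongr
            calc (24 : ℝ) ≤ 3 ^ 3 := by norm_num
              _ ≤ 3 ^ n := pow_le_pow_right₀ (by norm_num) (by omega)
        _ = lam / 3 * 24 ^ n := by rw [← mul_pow]; norm_num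
        _ ≤ lam / 3 * (lam / 3) ^ n := by gcongr; linarith
        _ = _ := by ring
    exact le_of_mul_le_mul_left (by linarith) hl0
  rw [hrec]
  have : 13 / lam * (lam * ((n ! : ℝ) * p ^ n)) = 13 * ((n ! : ℝ) * p ^ n) := by field_simp
  rw [this]
  simp only [Nat.add_sub_cancel]
  linarith

section SharedLevels

variable {α : Type} [Fintype α] [LinearOrder α]

/-- The fixed points of `σ` whose set of predecessors is preserved by `σ`. -/
def sharedLevels (σ : Equiv.Perm α) : Finset α :=
  univ.filter fun k => σ k = k ∧ ∀ j, σ j < k ↔ j < k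

theorem mem_sharedLevels {σ : Equiv.Perm α} {k : α} :
    k ∈ sharedLevels σ ↔ σ k = k ∧ ∀ j, σ j < k ↔ j < k := by
  simp [sharedLevels]

theorem lt_apply_iff_of_mem_sharedLevels {σ : Equiv.Perm α} {k : α} (h : k ∈ sharedLevels σ)
    (j : α) : k < σ j ↔ k < j := by
  obtain ⟨h1, h2⟩ := mem_sharedLevels.mp h
  have h3 : σ j = k ↔ j = k := by
    constructor
    · intro h; exact σ.injective (h.trans h1.symm)
    · rintro rfl; exact h1
  have := h2 j
  rw [← not_le, ← not_le, le_iff_lt_or_eq, le_iff_lt_or_eq, this, h3]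

/-- The restrictions of `σ` to the elements below and above a shared level `k`
(the identity permutations when `k` is not shared). -/
def restrictAround (k : α) (σ : Equiv.Perm α) :
    Equiv.Perm {x : α // x < k} × Equiv.Perm {x : α // k < x} :=
  if h : k ∈ sharedLevels σ then
    (σ.subtypePerm (mem_sharedLevels.mp h).2, σ.subtypePerm (lt_apply_iff_of_mem_sharedLevels h))
  else (1, 1)

theorem restrictAround_injOn (k : α) :
    Set.InjOn (restrictAround k) {σ : Equiv.Perm α | k ∈ sharedLevels σ} := by
  intro σ hσ τ hτ h
  change k ∈ sharedLevels σ at hσ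
  change k ∈ sharedLevels τ at hτ
  rw [restrictAround, restrictAround, dif_pos hσ, dif_pos hτ, Prod.mk.injEq] at h
  ext x
  rcases lt_trichotomy x k with hx | rfl | hx
  · simpa using congrArg Subtype.val (DFunLike.congr_fun h.1 ⟨x, hx⟩)
  · rw [(mem_sharedLevels.mp hσ).1, (mem_sharedLevels.mp hτ).1]
  · simpa using congrArg Subtype.val (DFunLike.congr_fun h.2 ⟨x, hx⟩)

theorem card_sharedLevels_le {σ : Equiv.Perm α} {k : α} (hk : k ∈ sharedLevels σ)
    (hmin : ∀ j ∈ sharedLevels σ, k ≤ j) :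
    #(sharedLevels σ) ≤ #(sharedLevels (restrictAround k σ).2) + 1 := by
  have hsub : sharedLevels σ ⊆
      insert k ((sharedLevels (restrictAround k σ).2).map (Function.Embedding.subtype _)) := by
    intro l hl
    rcases (hmin l hl).eq_or_lt with rfl | hlt
    · exact mem_insert_self _ _
    refine mem_insert_of_mem (mem_map.mpr ⟨⟨l, hlt⟩, ?_, rfl⟩)
    obtain ⟨h1, h2⟩ := mem_sharedLevels.mp hl
    rw [restrictAround, dif_pos hk, mem_sharedLevels]
    exact ⟨Subtype.ext h1, fun j => h2 j⟩
  refine (card_le_card hsub).trans ((card_insert_le _ _).trans ?_)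
  rw [card_map]

theorem sum_pow_sharedLevels_of_min_le {q : ℝ} (hq : 1 ≤ q) (k : α) :
    ∑ σ : Equiv.Perm α with k ∈ sharedLevels σ ∧ ∀ j ∈ sharedLevels σ, k ≤ j,
        q ^ #(sharedLevels σ) ≤
      ((Fintype.card {x : α // x < k})! : ℝ) *
        (q * ∑ τ : Equiv.Perm {x : α // k < x}, q ^ #(sharedLevels τ)) := by
  classical
  set S : Finset (Equiv.Perm α) :=
    univ.filter fun σ => k ∈ sharedLevels σ ∧ ∀ j ∈ sharedLevels σ, k ≤ j with hS
  set G : Equiv.Perm {x : α // x < k} × Equiv.Perm {x : α // k < x} → ℝ :=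
    fun x => q ^ (#(sharedLevels x.2) + 1) with hG
  have hq0 : 0 ≤ q := by linarith
  calc ∑ σ ∈ S, q ^ #(sharedLevels σ) ≤ ∑ σ ∈ S, G (restrictAround k σ) := by
        refine sum_le_sum fun σ hσ => pow_le_pow_right₀ hq ?_
        have h := (mem_filter.mp hσ).2
        exact card_sharedLevels_le h.1 h.2
    _ = ∑ x ∈ S.image (restrictAround k), G x := by
        rw [sum_image]
        intro σ hσ τ hτ h
        exact restrictAround_injOn k (mem_filter.mp hσ).2.1 (mem_filter.mp hτ).2.1 h
    _ ≤ ∑ x, G x :=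
        sum_le_sum_of_subset_of_nonneg (subset_univ _) fun _ _ _ => by positivity
    _ = _ := by
        rw [Fintype.sum_prod_type]
        simp only [hG, pow_succ', ← mul_sum, sum_const, card_univ, Fintype.card_perm,
          nsmul_eq_mul]
        ring

theorem sum_pow_sharedLevels_nonempty_le {q : ℝ} (hq : 1 ≤ q) :
    ∑ σ : Equiv.Perm α with (sharedLevels σ).Nonempty, q ^ #(sharedLevels σ) ≤
      ∑ k : α, ((Fintype.card {x : α // x < k})! : ℝ) *
        (q * ∑ τ : Equiv.Perm {x : α // k < x}, q ^ #(sharedLevels τ)) := by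
  have hq0 : 0 ≤ q := by linarith
  refine le_trans ?_ (sum_le_sum fun k _ => sum_pow_sharedLevels_of_min_le hq k)
  simp only [sum_filter]
  rw [sum_comm]
  refine sum_le_sum fun σ _ => ?_
  split_ifs with h
  · refine le_trans (le_of_eq ?_)
      (single_le_sum (fun k _ => ?_) (mem_univ ((sharedLevels σ).min' h)))
    · rw [if_pos ⟨min'_mem _ _, fun j hj => min'_le _ _ hj⟩]
    · split_ifs <;> positivity
  · exact sum_nonneg fun k _ => by split_ifs <;> positivity

theorem sum_card_lt_eq_sum_range (f : ℕ → ℝ) :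
    ∑ k : α, f (Fintype.card {x : α // x < k}) = ∑ t ∈ range (Fintype.card α), f t := by
  rw [← Fin.sum_univ_eq_sum_range]
  set e : Fin (Fintype.card α) ≃o α := Fintype.orderIsoFinOfCardEq α rfl
  rw [← e.toEquiv.sum_comp]
  refine sum_congr rfl fun i _ => ?_
  congr 1
  have : Fintype.card {x : α // x < e i} = Fintype.card {j : Fin (Fintype.card α) // j < i} :=
    (Fintype.card_congr (e.toEquiv.subtypeEquiv fun j => by simp)).symm
  refine this.trans ?_
  rw [Fintype.card_subtype, filter_gt_eq_Iio, Fin.card_Iio]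

theorem card_lt_add_card_gt (k : α) :
    Fintype.card {x : α // x < k} + 1 + Fintype.card {x : α // k < x} = Fintype.card α := by
  classical
  have h1 := card_filter_add_card_filter_not (s := (univ : Finset α)) (· < k)
  have h2 : univ.filter (fun x => ¬ x < k) = insert k (univ.filter (k < ·)) := by
    ext x
    simp [le_iff_eq_or_lt, eq_comm]
  rw [h2, card_insert_of_notMem (by simp), card_univ] at h1
  rw [Fintype.card_subtype, Fintype.card_subtype]
  omega

theorem pow_mul_sum_nonempty_le_of_le {p : ℝ} (hp : 0 < p) (hp1 : p ≤ 1) {v : ℕ → ℝ}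
    (hv : ∀ k : α, p ^ Fintype.card {x : α // k < x} *
      ∑ τ : Equiv.Perm {x : α // k < x}, p⁻¹ ^ #(sharedLevels τ) ≤
        v (Fintype.card {x : α // k < x})) :
    p ^ Fintype.card α *
        ∑ σ : Equiv.Perm α with (sharedLevels σ).Nonempty, p⁻¹ ^ #(sharedLevels σ) ≤
      ∑ t ∈ range (Fintype.card α), (t ! : ℝ) * p ^ t * v (Fintype.card α - 1 - t) := by
  have h := sum_pow_sharedLevels_nonempty_le (α := α) ((one_le_inv₀ hp).mpr hp1)
  rw [← sum_card_lt_eq_sum_range]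
  refine (mul_le_mul_of_nonneg_left h (by positivity)).trans ?_
  rw [mul_sum]
  refine sum_le_sum fun k _ => ?_
  have hc := card_lt_add_card_gt k
  have hk := hv k
  set a := Fintype.card {x : α // x < k}
  set b := Fintype.card {x : α // k < x}
  set Z := ∑ τ : Equiv.Perm {x : α // k < x}, p⁻¹ ^ #(sharedLevels τ)
  have hb : Fintype.card α - 1 - a = b := by omega
  rw [hb, ← hc]
  calc p ^ (a + 1 + b) * ((a ! : ℝ) * (p⁻¹ * Z)) = (a ! : ℝ) * p ^ a * (p ^ b * Z) := by
        rw [pow_add, pow_succ]; field_simp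
    _ ≤ _ := by gcongr

end SharedLevels

theorem pow_mul_sum_pow_sharedLevels_le {p : ℝ} (hp : 0 < p) (hp1 : p ≤ 1) (n : ℕ) :
    ∀ (α : Type) [Fintype α] [LinearOrder α], Fintype.card α = n →
      p ^ n * ∑ σ : Equiv.Perm α, p⁻¹ ^ #(sharedLevels σ) ≤ renewalSeq p n := by
  induction n using Nat.strong_induction_on with
  | _ n ih =>
    intro α _ _ hα
    have h := pow_mul_sum_nonempty_le_of_le (α := α) hp hp1 (v := renewalSeq p) fun k =>
      ih _ (by have := card_lt_add_card_gt k; omega) _ rfl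
    rw [hα] at h
    rw [renewalSeq_eq, ← sum_filter_add_sum_filter_not univ
      (fun σ : Equiv.Perm α => (sharedLevels σ).Nonempty), mul_add, add_comm]
    refine add_le_add ?_ h
    have h0 : ∑ σ : Equiv.Perm α with ¬ (sharedLevels σ).Nonempty, p⁻¹ ^ #(sharedLevels σ)
        ≤ (n ! : ℝ) := by
      calc _ = ∑ σ : Equiv.Perm α with ¬ (sharedLevels σ).Nonempty, (1 : ℝ) := by
            refine sum_congr rfl fun σ hσ => ?_
            rw [not_nonempty_iff_eq_empty.mp (mem_filter.mp hσ).2]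
            simp
        _ ≤ ∑ σ : Equiv.Perm α, (1 : ℝ) :=
            sum_le_sum_of_subset_of_nonneg (filter_subset _ _) fun _ _ _ => zero_le_one
        _ = (n ! : ℝ) := by
            rw [sum_const, card_univ, Fintype.card_perm, hα]; simp
    calc _ ≤ p ^ n * (n ! : ℝ) := by gcongr
      _ = _ := mul_comm _ _

theorem pow_mul_sum_nonempty_sharedLevels_le {p : ℝ} (hp : 0 < p) (hp1 : p ≤ 1) (n : ℕ) :
    p ^ n * ∑ σ : Equiv.Perm (Fin n) with (sharedLevels σ).Nonempty,
        p⁻¹ ^ #(sharedLevels σ) ≤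
      ∑ t ∈ range n, (t ! : ℝ) * p ^ t * renewalSeq p (n - 1 - t) := by
  have h := pow_mul_sum_nonempty_le_of_le (α := Fin n) hp hp1 (v := renewalSeq p) fun k =>
    pow_mul_sum_pow_sharedLevels_le hp hp1 _ _ rfl
  rwa [Fintype.card_fin] at h

section Janson

variable {E : Type*} [Fintype E]

/-- The probability of the configuration `ω` under independent Bernoulli(`p`) edges. -/
def configWeight (p : ℝ) (ω : E → Bool) : ℝ :=
  ∏ e, if ω e then p else 1 - p

theorem configWeight_nonneg {p : ℝ} (hp : 0 ≤ p) (hp1 : p ≤ 1) (ω : E → Bool) :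
    0 ≤ configWeight p ω :=
  prod_nonneg fun e _ => by split_ifs <;> linarith

theorem configWeight_mul_configWeight (p : ℝ) (ω ω' : E → Bool) :
    configWeight p ω * configWeight p ω' =
      configWeight p (ω ⊓ ω') * configWeight p (ω ⊔ ω') := by
  simp only [configWeight, ← prod_mul_distrib]
  refine prod_congr rfl fun e _ => ?_
  change _ = (if ω e ⊓ ω' e then p else 1 - p) * (if ω e ⊔ ω' e then p else 1 - p)
  generalize ω e = b
  generalize ω' e = b'
  cases b <;> cases b' <;> simp [mul_comm]

variable [DecidableEq E]

/-- The expectation of `f` under independent Bernoulli(`p`) edges. -/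
def configExp (p : ℝ) (f : (E → Bool) → ℝ) : ℝ :=
  ∑ ω, configWeight p ω * f ω

/-- The indicator that all the edges of `A` are open. -/
def allOpen (A : Finset E) (ω : E → Bool) : ℝ :=
  if ∀ e ∈ A, ω e = true then 1 else 0

theorem allOpen_nonneg (A : Finset E) (ω : E → Bool) : 0 ≤ allOpen A ω := by
  unfold allOpen; split_ifs <;> norm_num

theorem allOpen_monotone (A : Finset E) : Monotone (allOpen A) := by
  intro ω ω' h
  unfold allOpen
  split_ifs with h1 h2
  · exact le_rfl
  · exact absurd (fun e he => top_le_iff.mp ((h1 e he).symm.le.trans (h e))) h2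
  · exact zero_le_one
  · exact le_rfl

theorem allOpen_mul_allOpen (A B : Finset E) (ω : E → Bool) :
    allOpen A ω * allOpen B ω = allOpen (A ∪ B) ω := by
  simp only [allOpen, mem_union, or_imp, forall_and, ite_and, mul_ite, mul_one, mul_zero]
  split_ifs <;> rfl

theorem configExp_mono {p : ℝ} (hp : 0 ≤ p) (hp1 : p ≤ 1) {f g : (E → Bool) → ℝ}
    (h : ∀ ω, f ω ≤ g ω) : configExp p f ≤ configExp p g :=
  sum_le_sum fun ω _ => mul_le_mul_of_nonneg_left (h ω) (configWeight_nonneg hp hp1 ω)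

theorem configExp_nonneg {p : ℝ} (hp : 0 ≤ p) (hp1 : p ≤ 1) {f : (E → Bool) → ℝ}
    (h : ∀ ω, 0 ≤ f ω) : 0 ≤ configExp p f :=
  sum_nonneg fun ω _ => mul_nonneg (configWeight_nonneg hp hp1 ω) (h ω)

theorem configExp_sub (p : ℝ) (f g : (E → Bool) → ℝ) :
    configExp p (fun ω => f ω - g ω) = configExp p f - configExp p g := by
  simp only [configExp, mul_sub, sum_sub_distrib]

theorem configExp_const_mul (p c : ℝ) (f : (E → Bool) → ℝ) :
    configExp p (fun ω => c * f ω) = c * configExp p f := by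
  simp only [configExp, mul_sum]
  exact sum_congr rfl fun ω _ => by ring

theorem configExp_sum {ι : Type*} (s : Finset ι) (p : ℝ) (f : ι → (E → Bool) → ℝ) :
    configExp p (fun ω => ∑ i ∈ s, f i ω) = ∑ i ∈ s, configExp p (f i) := by
  simp only [configExp, mul_sum]
  exact sum_comm

theorem configExp_one (p : ℝ) : configExp p (fun _ : E → Bool => 1) = 1 := by
  have h := Finset.prod_univ_sum (fun _ : E => (univ : Finset Bool))
    (fun (_ : E) (b : Bool) => if b then p else 1 - p)
  simp only [Fintype.piFinset_univ] at h
  simp only [configExp, mul_one, configWeight]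
  rw [← h]
  simp

/-- **Harris' inequality** for an increasing and a decreasing function. -/
theorem configExp_mul_le {p : ℝ} (hp : 0 ≤ p) (hp1 : p ≤ 1) {f g : (E → Bool) → ℝ}
    (hf0 : ∀ ω, 0 ≤ f ω) (hf : Monotone f) (hg1 : ∀ ω, g ω ≤ 1) (hg : Antitone g) :
    configExp p (fun ω => f ω * g ω) ≤ configExp p f * configExp p g := by
  have h := fkg f (fun ω => 1 - g ω) (configWeight p) (configWeight_nonneg hp hp1) hf0
    (fun ω => sub_nonneg.mpr (hg1 ω)) hf (fun a b hab => sub_le_sub_left (hg hab) 1)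
    (fun a b => (configWeight_mul_configWeight p a b).le)
  have h1 : ∑ ω : E → Bool, configWeight p ω = 1 := by simpa [configExp] using configExp_one p
  have h2 : configExp p (fun ω : E → Bool => 1 - g ω) = 1 - configExp p g := by
    rw [configExp_sub, configExp_one]
  have h3 : configExp p (fun ω => f ω * (1 - g ω)) =
      configExp p f - configExp p (fun ω => f ω * g ω) := by
    rw [← configExp_sub]
    congr 1
    ext ω
    ring
  rw [h1, one_mul] at h
  change configExp p f * configExp p (fun ω => 1 - g ω) ≤
    configExp p (fun ω => f ω * (1 - g ω)) at h
  rw [h2, h3] at h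
  linarith

theorem configWeight_update (p : ℝ) (ω : E → Bool) (a : E) (h : ω a = false) :
    (1 - p) * configWeight p (Function.update ω a true) = p * configWeight p ω := by
  unfold configWeight
  rw [← mul_prod_erase univ _ (mem_univ a), ← mul_prod_erase univ _ (mem_univ a), h]
  have : ∀ e ∈ univ.erase a, (if Function.update ω a true e then p else 1 - p) =
      if ω e then p else 1 - p := fun e he => by
    rw [Function.update_of_ne (ne_of_mem_erase he)]
  rw [prod_congr rfl this]
  simp
  ring

theorem configExp_ite_eq_true (p : ℝ) (a : E) (f : (E → Bool) → ℝ) :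
    configExp p (fun ω => (if ω a = true then 1 else 0) * f ω) =
      p * configExp p (fun ω => f (Function.update ω a true)) := by
  have hflip : (1 - p) * ∑ ω : E → Bool with ω a = true, configWeight p ω * f ω =
      p * ∑ ω : E → Bool with ¬ ω a = true,
        configWeight p ω * f (Function.update ω a true) := by
    rw [mul_sum, mul_sum]
    symm
    refine sum_nbij' (fun ω => Function.update ω a true) (fun ω => Function.update ω a false)
      ?_ ?_ ?_ ?_ ?_
    · intro ω _; simp
    · intro ω _; simp
    · intro ω hω
      have : ω a = false := by simpa using hω
      simp [← this]
    · intro ω hω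
      have : ω a = true := by simpa using hω
      simp [← this]
    · intro ω hω
      have : ω a = false := by simpa using hω
      rw [← mul_assoc, ← configWeight_update p ω a this, mul_assoc]
  have hsplit : configExp p (fun ω => f (Function.update ω a true)) =
      ∑ ω : E → Bool with ω a = true, configWeight p ω * f ω +
      ∑ ω : E → Bool with ¬ ω a = true,
        configWeight p ω * f (Function.update ω a true) := by
    rw [configExp, ← sum_filter_add_sum_filter_not univ (fun ω : E → Bool => ω a = true)]
    congr 1
    refine sum_congr rfl fun ω hω => ?_
    rw [← (mem_filter.mp hω).2, Function.update_eq_self]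
  have hleft : configExp p (fun ω => (if ω a = true then 1 else 0) * f ω) =
      ∑ ω : E → Bool with ω a = true, configWeight p ω * f ω := by
    rw [configExp, sum_filter]
    exact sum_congr rfl fun ω _ => by split_ifs <;> simp
  rw [hleft, hsplit, mul_add, ← hflip]
  ring

/-- The configuration obtained from `ω` by opening the edges of `A`. -/
def openEdges (A : Finset E) (ω : E → Bool) : E → Bool :=
  fun e => ω e || decide (e ∈ A)

theorem configExp_allOpen_mul (p : ℝ) (A : Finset E) (f : (E → Bool) → ℝ) :
    configExp p (fun ω => allOpen A ω * f ω) =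
      p ^ #A * configExp p (fun ω => f (openEdges A ω)) := by
  induction A using Finset.induction_on generalizing f with
  | empty => 
    have h : ∀ ω : E → Bool, openEdges ∅ ω = ω := fun ω => by ext e; simp [openEdges]
    simp [allOpen, h]
  | insert a A ha ih =>
    have h1 : ∀ ω : E → Bool, allOpen (insert a A) ω * f ω =
        (if ω a = true then 1 else 0) * (allOpen A ω * f ω) := fun ω => by
      simp only [allOpen, forall_mem_insert, ite_and]
      split_ifs <;> simp
    have h2 : ∀ ω : E → Bool, allOpen A (Function.update ω a true) = allOpen A ω := fun ω => by
      unfold allOpen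
      congr 1
      refine propext (forall₂_congr fun e he => ?_)
      rw [Function.update_of_ne (ne_of_mem_of_not_mem he ha)]
    have h3 : ∀ ω : E → Bool, Function.update (openEdges A ω) a true =
        openEdges (insert a A) ω := fun ω => by
      ext e
      by_cases he : e = a
      · subst he; simp [openEdges]
      · simp [openEdges, he]
    simp only [h1]
    rw [configExp_ite_eq_true]
    simp only [h2]
    rw [ih (fun ω => f (Function.update ω a true)), card_insert_of_notMem ha, pow_succ']
    simp only [h3]
    ring

theorem configExp_allOpen (p : ℝ) (A : Finset E) : configExp p (allOpen A) = p ^ #A := by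
  have h := configExp_allOpen_mul p A (fun _ => 1)
  simpa only [mul_one, configExp_one] using h

variable {ι : Type*}

/-- The number of sets of the family `A` all of whose edges are open. -/
def openCount (A : ι → Finset E) (s : Finset ι) (ω : E → Bool) : ℝ :=
  ∑ i ∈ s, allOpen (A i) ω

theorem openCount_nonneg (A : ι → Finset E) (s : Finset ι) (ω : E → Bool) :
    0 ≤ openCount A s ω :=
  sum_nonneg fun _ _ => allOpen_nonneg _ _

variable [Fintype ι]

theorem le_configExp_allOpen_mul_exp {p : ℝ} (hp : 0 ≤ p) (hp1 : p ≤ 1) (A : ι → Finset E)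
    (i : ι) {s : ℝ} (hs : 0 ≤ s) :
    (p ^ #(A i) - s * ∑ j with ¬ Disjoint (A i) (A j), p ^ #(A i ∪ A j)) *
        configExp p (fun ω => Real.exp (-s * openCount A univ ω)) ≤
      configExp p (fun ω => allOpen (A i) ω * Real.exp (-s * openCount A univ ω)) := by
  set near : Finset ι := univ.filter fun j => ¬ Disjoint (A i) (A j) with hnear
  set far : Finset ι := univ.filter fun j => ¬¬ Disjoint (A i) (A j) with hfar
  set δ := ∑ j ∈ near, p ^ #(A i ∪ A j) with hδ
  have hsplit : ∀ ω, openCount A univ ω = openCount A near ω + openCount A far ω := fun ω =>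
    (sum_filter_add_sum_filter_not univ _ _).symm
  rcases le_total (p ^ #(A i) - s * δ) 0 with hneg | hpos
  · refine (mul_nonpos_of_nonpos_of_nonneg hneg
      (configExp_nonneg hp hp1 fun ω => (Real.exp_pos _).le)).trans
      (configExp_nonneg hp hp1 fun ω => mul_nonneg (allOpen_nonneg _ _) (Real.exp_pos _).le)
  set g : (E → Bool) → ℝ := fun ω => Real.exp (-s * openCount A far ω) with hg
  have hg_anti : Antitone g := by
    intro ω ω' h
    refine Real.exp_le_exp.mpr ?_
    have : openCount A far ω ≤ openCount A far ω' := sum_le_sum fun j _ => allOpen_monotone _ h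
    nlinarith
  have hg_le : ∀ ω, g ω ≤ 1 := fun ω => Real.exp_le_one_iff.mpr (by
    have := openCount_nonneg A far ω
    nlinarith)
  have hfull_le : configExp p (fun ω => Real.exp (-s * openCount A univ ω)) ≤ configExp p g := by
    refine configExp_mono hp hp1 fun ω => Real.exp_le_exp.mpr ?_
    have := openCount_nonneg A near ω
    rw [hsplit]
    nlinarith
  have hindep : configExp p (fun ω => allOpen (A i) ω * g ω) = p ^ #(A i) * configExp p g := by
    rw [configExp_allOpen_mul]
    congr 2
    ext ω
    simp only [hg]
    congr 2
    refine sum_congr rfl fun j hj => ?_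
    have hdisj : Disjoint (A i) (A j) := by simpa [hfar] using hj
    unfold allOpen
    congr 1
    refine propext (forall₂_congr fun e he => ?_)
    simp [openEdges, disjoint_right.mp hdisj he]
  have hharris : configExp p (fun ω => (allOpen (A i) ω * openCount A near ω) * g ω) ≤
      δ * configExp p g := by
    refine (configExp_mul_le hp hp1
      (fun ω => mul_nonneg (allOpen_nonneg _ _) (openCount_nonneg _ _ _)) ?_ hg_le
      hg_anti).trans_eq ?_
    · intro ω ω' h
      exact mul_le_mul (allOpen_monotone _ h) (sum_le_sum fun j _ => allOpen_monotone _ h)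
        (openCount_nonneg _ _ _) (allOpen_nonneg _ _)
    · congr 1
      simp only [openCount, mul_sum, allOpen_mul_allOpen]
      rw [configExp_sum]
      exact sum_congr rfl fun j _ => configExp_allOpen p _
  calc _ ≤ (p ^ #(A i) - s * δ) * configExp p g := by gcongr
    _ ≤ configExp p (fun ω => allOpen (A i) ω * g ω) -
          s * configExp p (fun ω => (allOpen (A i) ω * openCount A near ω) * g ω) := by
        rw [hindep]
        nlinarith
    _ = configExp p (fun ω => allOpen (A i) ω * g ω -
          s * ((allOpen (A i) ω * openCount A near ω) * g ω)) := by
        rw [configExp_sub, configExp_const_mul]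
    _ ≤ _ := by
        refine configExp_mono hp hp1 fun ω => ?_
        have h1 : Real.exp (-s * openCount A univ ω) =
            Real.exp (-s * openCount A near ω) * g ω := by
          rw [hg, ← Real.exp_add, hsplit]
          ring_nf
        have h2 := Real.add_one_le_exp (-s * openCount A near ω)
        rw [h1]
        calc _ = allOpen (A i) ω * ((-s * openCount A near ω + 1) * g ω) := by ring
          _ ≤ _ := by
            have := allOpen_nonneg (A i) ω
            have : 0 ≤ g ω := (Real.exp_pos _).le
            gcongr

theorem configExp_exp_neg_openCount_le {p : ℝ} (hp : 0 ≤ p) (hp1 : p ≤ 1)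
    (A : ι → Finset E) {s : ℝ} (hs : 0 ≤ s) :
    configExp p (fun ω => Real.exp (-s * openCount A univ ω)) ≤
      Real.exp (-s * ∑ i, p ^ #(A i) +
        s ^ 2 / 2 * ∑ i, ∑ j with ¬ Disjoint (A i) (A j), p ^ #(A i ∪ A j)) := by
  set M := ∑ i, p ^ #(A i) with hM
  set Δ := ∑ i, ∑ j with ¬ Disjoint (A i) (A j), p ^ #(A i ∪ A j) with hΔ
  set L : ℝ → ℝ := fun s => configExp p (fun ω => Real.exp (-s * openCount A univ ω)) with hL
  set L' : ℝ → ℝ := fun s =>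
    configExp p (fun ω => openCount A univ ω * Real.exp (-s * openCount A univ ω)) with hL'
  have hderivL : ∀ s, HasDerivAt L (-L' s) s := fun s => by
    have h : HasDerivAt L (∑ ω : E → Bool, configWeight p ω *
        (Real.exp (-s * openCount A univ ω) * (-1 * openCount A univ ω))) s := by
      refine HasDerivAt.fun_sum fun ω _ => HasDerivAt.const_mul _ (HasDerivAt.exp ?_)
      exact ((hasDerivAt_id s).neg).mul_const _
    convert h using 1
    simp only [hL', configExp, ← sum_neg_distrib]
    exact sum_congr rfl fun ω _ => by ring
  have hineq : ∀ s, 0 ≤ s → (M - s * Δ) * L s ≤ L' s := fun s hs => by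
    have h := sum_le_sum fun i (_ : i ∈ (univ : Finset ι)) =>
      le_configExp_allOpen_mul_exp hp hp1 A i hs
    rw [← sum_mul, sum_sub_distrib, ← mul_sum, ← configExp_sum] at h
    simp only [← sum_mul] at h
    exact h
  set G : ℝ → ℝ := fun s => L s * Real.exp (s * M - s ^ 2 / 2 * Δ) with hG
  have hderivG : ∀ s, HasDerivAt G
      ((-L' s + L s * (M - s * Δ)) * Real.exp (s * M - s ^ 2 / 2 * Δ)) s := fun s => by
    have h1 : HasDerivAt (fun s : ℝ => s * M - s ^ 2 / 2 * Δ) (M - s * Δ) s := by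
      have h := ((hasDerivAt_id' s).mul_const M).sub
        ((((hasDerivAt_id' s).pow 2).div_const 2).mul_const Δ)
      refine h.congr_deriv ?_
      simp
    refine ((hderivL s).mul h1.exp).congr_deriv ?_
    ring
  have hanti : AntitoneOn G (Set.Ici 0) := by
    refine antitoneOn_of_deriv_nonpos (convex_Ici 0)
      (fun s _ => (hderivG s).continuousAt.continuousWithinAt)
      (fun s _ => (hderivG s).differentiableAt.differentiableWithinAt) fun s hs => ?_
    rw [interior_Ici] at hs
    rw [(hderivG s).deriv]
    have := hineq s (le_of_lt hs)
    exact mul_nonpos_of_nonpos_of_nonneg (by linarith) (Real.exp_pos _).le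
  have h0 : G 0 = 1 := by simp [hG, hL, configExp_one]
  have hle := hanti (Set.mem_Ici.mpr le_rfl) (Set.mem_Ici.mpr hs) hs
  rw [h0] at hle
  have hexp : -s * M + s ^ 2 / 2 * Δ = -(s * M - s ^ 2 / 2 * Δ) := by ring
  rw [hexp, Real.exp_neg, ← one_div, le_div_iff₀ (Real.exp_pos _)]
  exact hle

/-- **Janson's inequality**: the probability that no set of the family `A` is open. -/
theorem janson_inequality {p : ℝ} (hp : 0 ≤ p) (hp1 : p ≤ 1) (A : ι → Finset E) {D : ℝ}
    (hD : 0 < D)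
    (hΔ : ∑ i, ∑ j with ¬ Disjoint (A i) (A j), p ^ #(A i ∪ A j) ≤ D) :
    configExp p (fun ω => if ∃ i, ∀ e ∈ A i, ω e = true then 0 else 1) ≤
      Real.exp (-(∑ i, p ^ #(A i)) ^ 2 / (2 * D)) := by
  set M := ∑ i, p ^ #(A i) with hM
  have hM0 : 0 ≤ M := sum_nonneg fun i _ => by positivity
  have hs : 0 ≤ M / D := by positivity
  calc _ ≤ configExp p (fun ω => Real.exp (-(M / D) * openCount A univ ω)) := by
        refine configExp_mono hp hp1 fun ω => ?_
        split_ifs with h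
        · exact (Real.exp_pos _).le
        · have : openCount A univ ω = 0 := sum_eq_zero fun i _ =>
            if_neg fun hi => h ⟨i, hi⟩
          simp [this]
    _ ≤ _ := configExp_exp_neg_openCount_le hp hp1 A hs
    _ ≤ _ := by
        refine Real.exp_le_exp.mpr ?_
        calc _ ≤ -(M / D) * M + (M / D) ^ 2 / 2 * D := by gcongr
          _ = _ := by field_simp; ring

end Janson

section Paths

variable {d : ℕ}

/-- The vertex reached after `k` steps by the path flipping the coordinates in the order
`σ 0, σ 1, …`. -/
def pathVertex (σ : Equiv.Perm (Fin d)) (k : ℕ) : Fin d → Bool :=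
  fun i => decide ((σ.symm i : ℕ) < k)

theorem pathVertex_succ (σ : Equiv.Perm (Fin d)) (k : Fin d) :
    pathVertex σ (k + 1) = Function.update (pathVertex σ k) (σ k) true := by
  funext i
  by_cases hi : i = σ k
  · subst hi; simp [pathVertex]
  · have hne : σ.symm i ≠ k := fun h => hi (by rw [← h, Equiv.apply_symm_apply])
    have hne' : (σ.symm i : ℕ) ≠ k := fun h => hne (Fin.ext h)
    rw [Function.update_of_ne hi]
    exact decide_eq_decide.mpr (by omega)

/-- The `k`-th edge of the path `σ`. -/
def pathEdge (σ : Equiv.Perm (Fin d)) (k : Fin d) : HCEdge d :=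
  ⟨(pathVertex σ k, pathVertex σ (k + 1)), σ k, by simp [pathVertex], pathVertex_succ σ k⟩

theorem card_pathVertex_eq_true (σ : Equiv.Perm (Fin d)) (k : Fin d) :
    #{i | pathVertex σ k i = true} = k := by
  have h : univ.filter (fun i => pathVertex σ k i = true) = (Iio k).map σ.toEmbedding := by
    ext i
    simp [pathVertex, mem_map_equiv]
  rw [h, card_map, Fin.card_Iio]

theorem level_eq_of_pathEdge_eq {σ τ : Equiv.Perm (Fin d)} {k l : Fin d}
    (h : pathEdge σ k = pathEdge τ l) : k = l := by
  have hv : pathVertex σ k = pathVertex τ l := congrArg (fun e : HCEdge d => e.1.1) h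
  exact Fin.ext (by rw [← card_pathVertex_eq_true σ k, ← card_pathVertex_eq_true τ l, hv])

theorem pathEdge_injective (σ : Equiv.Perm (Fin d)) : Function.Injective (pathEdge σ) :=
  fun _ _ h => level_eq_of_pathEdge_eq h

/-- The set of edges of the path `σ`. -/
def pathEdges (σ : Equiv.Perm (Fin d)) : Finset (HCEdge d) :=
  univ.image (pathEdge σ)

theorem card_pathEdges (σ : Equiv.Perm (Fin d)) : #(pathEdges σ) = d := by
  rw [pathEdges, card_image_of_injective _ (pathEdge_injective σ), card_univ, Fintype.card_fin]

theorem mem_sharedLevels_of_pathEdge_eq {σ τ : Equiv.Perm (Fin d)} {k : Fin d}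
    (h : pathEdge σ k = pathEdge τ k) : k ∈ sharedLevels (σ⁻¹ * τ) := by
  have hv : ∀ i, σ.symm i < k ↔ τ.symm i < k := fun i => by
    have := congrFun (congrArg (fun e : HCEdge d => e.1.1) h) i
    simpa [pathEdge, pathVertex] using this
  have hv' : ∀ i, σ.symm i ≤ k ↔ τ.symm i ≤ k := fun i => by
    have := congrFun (congrArg (fun e : HCEdge d => e.1.2) h) i
    simpa [pathEdge, pathVertex, Nat.lt_succ_iff] using this
  refine mem_sharedLevels.mpr ⟨?_, fun j => by simpa using hv (τ j)⟩
  have h1 := hv (τ k)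
  have h2 := hv' (τ k)
  simp only [Equiv.symm_apply_apply, lt_irrefl, iff_false, not_lt, le_refl, iff_true] at h1 h2
  exact le_antisymm h2 h1

theorem card_inter_pathEdges_le (σ τ : Equiv.Perm (Fin d)) :
    #(pathEdges σ ∩ pathEdges τ) ≤ #(sharedLevels (σ⁻¹ * τ)) := by
  have hsub : pathEdges σ ∩ pathEdges τ ⊆ (sharedLevels (σ⁻¹ * τ)).image (pathEdge σ) := by
    intro e he
    obtain ⟨h1, h2⟩ := mem_inter.mp he
    obtain ⟨k, -, rfl⟩ := mem_image.mp h1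
    obtain ⟨l, -, hl⟩ := mem_image.mp h2
    obtain rfl := level_eq_of_pathEdge_eq hl
    exact mem_image_of_mem _ (mem_sharedLevels_of_pathEdge_eq hl.symm)
  exact (card_le_card hsub).trans card_image_le

theorem sum_pow_union_pathEdges_le {p : ℝ} (hp : 0 < p) (hp1 : p ≤ 1)
    (σ : Equiv.Perm (Fin d)) :
    ∑ τ with ¬ Disjoint (pathEdges σ) (pathEdges τ), p ^ #(pathEdges σ ∪ pathEdges τ) ≤
      p ^ d * (p ^ d * ∑ τ : Equiv.Perm (Fin d) with (sharedLevels τ).Nonempty,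
        p⁻¹ ^ #(sharedLevels τ)) := by
  have hq : 1 ≤ p⁻¹ := (one_le_inv₀ hp).mpr hp1
  have hq0 : 0 ≤ p⁻¹ := by linarith
  have hreindex : ∑ τ : Equiv.Perm (Fin d) with (sharedLevels τ).Nonempty,
      p⁻¹ ^ #(sharedLevels τ) = ∑ τ : Equiv.Perm (Fin d) with
        (sharedLevels (σ⁻¹ * τ)).Nonempty, p⁻¹ ^ #(sharedLevels (σ⁻¹ * τ)) := by
    rw [sum_filter, sum_filter, ← Equiv.sum_comp (Equiv.mulLeft σ⁻¹)]
    rfl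
  rw [hreindex, ← mul_assoc, mul_sum]
  refine (sum_le_sum fun τ _ => ?_).trans
    (sum_le_sum_of_subset_of_nonneg (fun τ hτ => ?_) fun _ _ _ => by positivity)
  · have hcard := card_union_add_card_inter (pathEdges σ) (pathEdges τ)
    rw [card_pathEdges, card_pathEdges] at hcard
    rw [← pow_add, ← hcard, pow_add, mul_assoc]
    have h1 : 1 ≤ p ^ #(pathEdges σ ∩ pathEdges τ) * p⁻¹ ^ #(sharedLevels (σ⁻¹ * τ)) := by
      calc (1 : ℝ) = p ^ #(pathEdges σ ∩ pathEdges τ) * p⁻¹ ^ #(pathEdges σ ∩ pathEdges τ) := by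
            rw [← mul_pow, mul_inv_cancel₀ hp.ne', one_pow]
        _ ≤ _ := by
            gcongr
            exact card_inter_pathEdges_le σ τ
    exact le_mul_of_one_le_right (by positivity) h1
  · have hτ' := (mem_filter.mp hτ).2
    refine mem_filter.mpr ⟨mem_univ _, card_pos.mp ?_⟩
    refine lt_of_lt_of_le (card_pos.mpr ?_) (card_inter_pathEdges_le σ τ)
    exact not_disjoint_iff_nonempty_inter.mp hτ'

theorem percReach_of_pathEdges_open (cfg : HCEdge d → Bool) (σ : Equiv.Perm (Fin d))
    (h : ∀ e ∈ pathEdges σ, cfg e = true) :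
    percReach cfg (fun _ => false) (fun _ => true) := by
  have hreach : ∀ k ≤ d, percReach cfg (pathVertex σ 0) (pathVertex σ k) := by
    intro k
    induction k with
    | zero => exact fun _ => Relation.ReflTransGen.refl
    | succ k ih =>
      intro hk
      exact (ih (by omega)).tail
        ⟨pathEdge σ ⟨k, hk⟩, h _ (mem_image_of_mem _ (mem_univ _)), rfl, rfl⟩
  have h0 : pathVertex σ 0 = fun _ => false := by ext i; simp [pathVertex]
  have hd : pathVertex σ d = fun _ => true := by ext i; simp [pathVertex]
  rw [← h0, ← hd]
  exact hreach d le_rfl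

end Paths

section Measure

instance isProbabilityMeasure_bernoulliBool {p : ℝ} [hp : Fact (p ∈ Set.Icc (0 : ℝ) 1)] :
    IsProbabilityMeasure (bernoulliBool p) := by
  constructor
  obtain ⟨h0, h1⟩ := hp.out
  simp only [bernoulliBool, Measure.coe_add, Measure.coe_smul, Pi.add_apply, Pi.smul_apply,
    measure_univ, smul_eq_mul, mul_one]
  rw [← ENNReal.ofReal_add h0 (by linarith)]
  simp

theorem percMeasure_singleton {d : ℕ} {p : ℝ} (hp : p ∈ Set.Icc (0 : ℝ) 1)
    (cfg : HCEdge d → Bool) :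
    (percMeasure d p {cfg}).toReal = configWeight p cfg := by
  have : Fact (p ∈ Set.Icc (0 : ℝ) 1) := ⟨hp⟩
  rw [percMeasure, Measure.pi_singleton, ENNReal.toReal_prod, configWeight]
  refine prod_congr rfl fun e _ => ?_
  obtain ⟨h0, h1⟩ := hp
  have h1' : 0 ≤ 1 - p := by linarith
  cases cfg e <;> simp [bernoulliBool, h0, h1']

theorem percMeasure_toReal {d : ℕ} {p : ℝ} (hp : p ∈ Set.Icc (0 : ℝ) 1)
    (S : Set (HCEdge d → Bool)) [DecidablePred (· ∈ S)] :
    (percMeasure d p S).toReal = configExp p (fun cfg => if cfg ∈ S then 1 else 0) := by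
  have : Fact (p ∈ Set.Icc (0 : ℝ) 1) := ⟨hp⟩
  have : IsProbabilityMeasure (percMeasure d p) := by unfold percMeasure; infer_instance
  have hS : S = ((univ.filter (· ∈ S) : Finset (HCEdge d → Bool)) : Set (HCEdge d → Bool)) := by
    ext; simp
  conv_lhs => rw [hS]
  rw [← sum_measure_singleton, ENNReal.toReal_sum fun _ _ => measure_ne_top _ _]
  simp only [percMeasure_singleton hp, configExp, mul_ite, mul_one, mul_zero, sum_filter]

end Measure

theorem one_sub_exp_le_percMeasure {d : ℕ} (hd : 4 ≤ d) {lam : ℝ} (hlam : 72 ≤ lam)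
    (hlam' : lam ≤ d) :
    1 - Real.exp (-(lam / 26)) ≤
      (percMeasure d (lam / d) {cfg | percReach cfg (fun _ => false) (fun _ => true)}).toReal := by
  classical
  have hl0 : 0 < lam := by linarith
  have hd0 : (0 : ℝ) < d := by linarith
  set p := lam / d with hpdef
  have hp : 0 < p := by positivity
  have hp1 : p ≤ 1 := (div_le_one hd0).mpr hlam'
  set M : ℝ := (d ! : ℝ) * p ^ d with hM
  have hM0 : 0 < M := by positivity
  have hmean : ∑ σ : Equiv.Perm (Fin d), p ^ #(pathEdges σ) = M := by
    simp [card_pathEdges, Fintype.card_perm, hM]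
  have hcorr : ∑ σ : Equiv.Perm (Fin d), ∑ τ with ¬ Disjoint (pathEdges σ) (pathEdges τ),
      p ^ #(pathEdges σ ∪ pathEdges τ) ≤ 13 / lam * M ^ 2 := by
    calc _ ≤ ∑ σ : Equiv.Perm (Fin d), p ^ d * (13 / lam * M) := by
          refine sum_le_sum fun σ _ => (sum_pow_union_pathEdges_le hp hp1 σ).trans ?_
          refine mul_le_mul_of_nonneg_left ?_ (by positivity)
          exact (pow_mul_sum_nonempty_sharedLevels_le hp hp1 d).trans
            (sum_factorial_mul_renewalSeq_le_div hd hlam)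
      _ = _ := by
          rw [sum_const, card_univ, Fintype.card_perm, Fintype.card_fin, nsmul_eq_mul, hM]
          ring
  have hjanson := janson_inequality hp.le hp1 pathEdges (by positivity) hcorr
  rw [hmean] at hjanson
  have hexp : -M ^ 2 / (2 * (13 / lam * M ^ 2)) = -(lam / 26) := by
    field_simp
    norm_num
  rw [hexp] at hjanson
  rw [percMeasure_toReal ⟨hp.le, hp1⟩]
  have hcompl : 1 - configExp p (fun ω : HCEdge d → Bool =>
      if ∃ σ : Equiv.Perm (Fin d), ∀ e ∈ pathEdges σ, ω e = true then 0 else 1) ≤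
      configExp p (fun cfg : HCEdge d → Bool =>
        if cfg ∈ {cfg | percReach cfg (fun _ => false) (fun _ => true)} then 1 else 0) := by
    refine (congrArg (· - _) (configExp_one (E := HCEdge d) p).symm).trans_le ?_
    rw [← configExp_sub]
    refine configExp_mono hp.le hp1 fun ω => ?_
    by_cases hω : ∃ σ : Equiv.Perm (Fin d), ∀ e ∈ pathEdges σ, ω e = true
    · obtain ⟨σ, hσ⟩ := hω
      have hr : ω ∈ {cfg | percReach cfg (fun _ => false) (fun _ => true)} :=
        percReach_of_pathEdges_open ω σ hσ
      rw [if_pos ⟨σ, hσ⟩, if_pos hr, sub_zero]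
    · rw [if_neg hω, sub_self]
      split_ifs <;> norm_num
  refine le_trans ?_ hcompl
  convert sub_le_sub_left hjanson 1

end Auxiliary

/-- **Percolation on the oriented hypercube**: there is a universal constant `c > 0` such
that for every `d ≥ 1` and every `λ` with `10 ≤ λ ≤ d/10`, Bernoulli bond percolation with
parameter `λ/d` on `Q⃗_d` connects `(0,…,0)` to `(1,…,1)` with probability at least
`1 − 2 exp(−c λ)`. -/
theorem percolation_hypercube_bound :
    ∃ c : ℝ, 0 < c ∧ ∀ d : ℕ, 1 ≤ d → ∀ lam : ℝ, 10 ≤ lam → lam ≤ (d : ℝ) / 10 →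
      1 - 2 * Real.exp (-c * lam) ≤
        (percMeasure d (lam / d)
          {cfg | percReach cfg (fun _ => false) (fun _ => true)}).toReal := by
  refine ⟨1 / 200, by norm_num, fun d _ lam hlam hlam' => ?_⟩
  by_cases hbig : lam < 72
  · have h := Real.add_one_le_exp (-(1 / 200) * lam)
    refine le_trans ?_ ENNReal.toReal_nonneg
    linarith
  · push Not at hbig
    have hd : (4 : ℝ) ≤ d := by linarith
    refine le_trans ?_ (one_sub_exp_le_percMeasure (by exact_mod_cast hd) hbig (by linarith))
    have h1 : Real.exp (-(lam / 26)) ≤ Real.exp (-(1 / 200) * lam) :=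
      Real.exp_le_exp.mpr (by linarith)
    have h2 := Real.exp_pos (-(1 / 200) * lam)
    linarith

end
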